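/- For every nonnegative integer k, in ℤ[q]: RGF(L7(k);q) · ∏_{m∈M} [m]_q = ∏_{m∈M} [k+m]_q, where M is the multiset {1, 2, 3, 4, 5, 5, 6, 6, 7, 7, 8, 8, 9, 9, 9, 10, 10, 11, 11, 12, 12, 13, 13, 14, 15, 16, 17} (27 entries). -/

import Mathlib

noncomputable section

namespace CL

variable {N : Type} [DecidableEq N] [Fintype N]

/-- One-step relation generating the partial order on the poset of positions. -/
def step (adj : N → N → Prop) (pos : Finset (N × ℕ)) (x y : N × ℕ) : Prop :=
  x ∈ pos ∧ y ∈ pos ∧ adj x.1 y.1 ∧ y.2 = x.2 + 1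

/-- The partial order on positions, generated by `step`. -/
def ple (adj : N → N → Prop) (pos : Finset (N × ℕ)) : N × ℕ → N × ℕ → Prop :=
  Relation.ReflTransGen (step adj pos)

/-- The lattice of `ℕ`-labellings of the positions which are bounded by `k`, order-reversing,
and satisfy a further constraint `extra`. -/
def Elt (adj : N → N → Prop) (pos : Finset (N × ℕ)) (k : ℕ)
    (extra : ({x : N × ℕ // x ∈ pos} → ℕ) → Prop) : Type :=
  {c : {x : N × ℕ // x ∈ pos} → ℕ //
    (∀ x, c x ≤ k) ∧ (∀ x y, ple adj pos y.1 x.1 → c x ≤ c y) ∧ extra c}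

variable {adj : N → N → Prop} {pos : Finset (N × ℕ)} {k : ℕ}
  {extra : ({x : N × ℕ // x ∈ pos} → ℕ) → Prop}

instance : Finite (Elt adj pos k extra) := by
  apply Finite.of_injective
    (fun c : Elt adj pos k extra =>
      fun x => (⟨c.1 x, Nat.lt_succ_of_le (c.2.1 x)⟩ : Fin (k + 1)))
  intro c d h
  apply Subtype.ext
  funext x
  exact congrArg Fin.val (congrFun h x)

instance : Fintype (Elt adj pos k extra) := Fintype.ofFinite _

instance : DecidableEq (Elt adj pos k extra) := by unfold Elt; infer_instance

/-- Componentwise comparison of labellings. -/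
def elLe (r s : Elt adj pos k extra) : Prop := ∀ x, r.1 x ≤ s.1 x

/-- The covering edge of color `i`: exactly one entry, at a position of color `i`,
is increased by one. -/
def edge (i : N) (r s : Elt adj pos k extra) : Prop :=
  ∃ x : {x : N × ℕ // x ∈ pos}, x.1.1 = i ∧ s.1 x = r.1 x + 1 ∧
    ∀ y, y ≠ x → s.1 y = r.1 y

instance (i : N) (r s : Elt adj pos k extra) : Decidable (edge i r s) := by
  unfold edge; infer_instance

/-- The rank function: the sum of all entries. -/
def rk (t : Elt adj pos k extra) : ℕ := ∑ x ∈ pos.attach, t.1 x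

/-- The connected component of `t` in the graph of color-`i` covering edges. -/
def comp (i : N) (t : Elt adj pos k extra) : Set (Elt adj pos k extra) :=
  {s | Relation.ReflTransGen (fun a b => edge i a b ∨ edge i b a) t s}

/-- The integer `m_i(t) = (ρ(t) − min ρ on comp_i(t)) − (max ρ on comp_i(t) − ρ(t))`. -/
def mwt (i : N) (t : Elt adj pos k extra) : ℤ :=
  ((rk t : ℤ) - ((sInf (rk '' comp i t) : ℕ) : ℤ)) -
    (((sSup (rk '' comp i t) : ℕ) : ℤ) - (rk t : ℤ))

end CL

/-! ### Type `E₇` data -/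

/-- The nodes `1, 2, 3, 4, 5, 5', 6'` of the `E₇` Dynkin diagram. -/
inductive N7 : Type
  | n1 | n2 | n3 | n4 | n5 | n5p | n6p
  deriving DecidableEq

instance instFintypeN7 : Fintype N7 where
  elems := ⟨↑[N7.n1, N7.n2, N7.n3, N7.n4, N7.n5, N7.n5p, N7.n6p], by decide⟩
  complete := by intro x; cases x <;> decide

open N7

/-- Adjacency in the `E₇` Dynkin diagram: edges `1-2, 2-3, 3-4, 4-5, 4-5', 5'-6'`. -/
abbrev adj7 : N7 → N7 → Prop := fun a b =>
  (a, b) ∈ ([(n1, n2), (n2, n3), (n3, n4), (n4, n5), (n4, n5p), (n5p, n6p)] : List (N7 × N7)) ∨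
  (b, a) ∈ ([(n1, n2), (n2, n3), (n3, n4), (n4, n5), (n4, n5p), (n5p, n6p)] : List (N7 × N7))

/-- The 27 (color, rank) positions of the minuscule poset `P₇ = P_{E₇}(ω₁)`. -/
def pos7 : Finset (N7 × ℕ) :=
  {(n1, 0), (n2, 1), (n3, 2), (n4, 3), (n5, 4), (n5p, 4), (n4, 5), (n6p, 5), (n3, 6),
   (n5p, 6), (n2, 7), (n4, 7), (n1, 8), (n3, 8), (n5, 8), (n2, 9), (n4, 9), (n3, 10),
   (n5p, 10), (n4, 11), (n6p, 11), (n5, 12), (n5p, 12), (n4, 13), (n3, 14), (n2, 15), (n1, 16)}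

/-- The lattice `L7(k) = L_{E₇}(kω₁)` of order-reversing labellings of `P₇` by `{0,…,k}`. -/
abbrev L7 (k : ℕ) : Type := CL.Elt adj7 pos7 k (fun _ => True)

/-- The Cartan matrix of type `E₇`, indexed by the nodes. -/
def A7 : N7 → N7 → ℤ := fun i j => if i = j then 2 else if adj7 i j then -1 else 0

/-- The `q`-integer `[m]_q = 1 + q + ⋯ + q^{m−1}` in `ℤ[q]`. -/
def qint (m : ℕ) : Polynomial ℤ := ∑ i ∈ Finset.range m, Polynomial.X ^ i

/-- The multiset of `q`-integer indices for `E₇`. -/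
def M7 : List ℕ :=
  [1, 2, 3, 4, 5, 5, 6, 6, 7, 7, 8, 8, 9, 9, 9, 10, 10, 11, 11, 12, 12, 13, 13, 14, 15, 16, 17]

/-! ### Kernel computation -/

/-- Bit masks of the elements covered by each position. -/
def pmL : List ℕ := [0, 1, 2, 4, 8, 8, 48, 32, 64, 192, 256, 768, 1024, 3072, 2048, 12288, 24576,
  98304, 65536, 393216, 262144, 524288, 1572864, 6291456, 8388608, 16777216, 33554432]

/-- Bit masks of the 56 order ideals, each with its cardinality. -/
def idL : List (ℕ × ℕ) := [(0, 0), (1, 1), (3, 2), (7, 3), (15, 4), (31, 5), (47, 5), (63, 6),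
  (127, 7), (175, 6), (191, 7), (255, 8), (383, 8), (511, 9), (767, 9), (1023, 10), (1407, 9),
  (1535, 10), (2047, 11), (3071, 11), (4095, 12), (5503, 10), (5631, 11), (6143, 12), (8191, 13),
  (12287, 13), (16383, 14), (19455, 12), (20479, 13), (24575, 14), (28671, 14), (32767, 15),
  (49151, 15), (65535, 16), (94207, 15), (98303, 16), (131071, 17), (262143, 18), (356351, 16),
  (360447, 17), (393215, 18), (524287, 19), (1048575, 20), (1404927, 17), (1409023, 18),
  (1441791, 19), (1572863, 20), (2097151, 21), (3145727, 21), (4194303, 22), (6291455, 22),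
  (8388607, 23), (16777215, 24), (33554431, 25), (67108863, 26), (134217727, 27)]

/-- Apply `f` to the normal form of `n`. -/
def force {β : Type} (n : ℕ) (f : ℕ → β) : β := Nat.rec (f 0) (fun m _ => f (Nat.succ m)) n

theorem force_eq {β : Type} (n : ℕ) (f : ℕ → β) : force n f = f n := by
  cases n <;> rfl

/-- `κ (l.map fun x => (x.1, g x))` with forced evaluation. -/
def mapK {α β : Type} (g : α → ℕ) (l : List α) : (List (α × ℕ) → β) → β :=
  List.rec (fun κ => κ []) (fun x _ ih κ => force (g x) fun y => ih fun ys => κ ((x, y) :: ys)) l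

theorem mapK_eq {α β : Type} (g : α → ℕ) (l : List α) (κ : List (α × ℕ) → β) :
    mapK g l κ = κ (l.map fun x => (x, g x)) := by
  induction l generalizing κ with
  | nil => rfl
  | cons x xs ih =>
    show force (g x) (fun y => mapK g xs fun ys => κ ((x, y) :: ys)) = _
    rw [force_eq, ih]; rfl

/-- Sum of the weights of the ideals contained in the ideal `i`. -/
def sumL (i : ℕ) (l : List ((ℕ × ℕ) × ℕ)) : ℕ :=
  List.rec 0 (fun x _ ih => bif Nat.beq (Nat.land x.1.1 i) x.1.1 then Nat.add x.2 ih else ih) l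

/-- Geometric sum. -/
def geo (a m : ℕ) : ℕ := Nat.rec 0 (fun _ r => Nat.add (Nat.mul a r) 1) m

/-- Product of geometric sums. -/
def geoProd (a k : ℕ) (l : List ℕ) : ℕ :=
  List.rec 1 (fun m _ ih => Nat.mul (geo a (Nat.add k m)) ih) l

/-- The last value in a list. -/
def lastV (l : List ((ℕ × ℕ) × ℕ)) : ℕ :=
  List.rec (motive := fun _ => ℕ → ℕ) (fun d => d) (fun x _ ih _ => ih x.2) l 0

/-- Check the identity for `n` successive values of `k`, starting with `k` and state `l`. -/
def checkL (a n : ℕ) : ℕ → List ((ℕ × ℕ) × ℕ) → Bool :=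
  Nat.rec (fun _ _ => true) (fun _ ih k l =>
    bif Nat.beq (Nat.mul (lastV l) (geoProd a 0 M7)) (Nat.mul (Nat.pow a 27) (geoProd a k M7)) then
      mapK (fun x : ℕ × ℕ => Nat.mul (Nat.pow a x.2) (sumL x.1 l)) idL (ih (Nat.succ k))
    else false) n

/-- The initial state of the computation. -/
def initL (a : ℕ) : List ((ℕ × ℕ) × ℕ) := idL.map fun x => (x, Nat.pow a x.2)

theorem check_one : checkL 1 28 0 (initL 1) = true := by decide +kernel

/-- A large odd evaluation point (`2 ^ 160 + 1`). -/
abbrev bigA : ℕ := 1461501637330902918203684832716283019655932542977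

theorem check_big : checkL 1461501637330902918203684832716283019655932542977 28 0
    (initL 1461501637330902918203684832716283019655932542977) = true := by decide +kernel

/-! ### The recursion over order ideals -/

/-- The covering relation on `Fin 27`. -/
def rel (i j : Fin 27) : Bool := (pmL.getD j 0).testBit i

/-- Order ideals. -/
def IsLow (S : Finset (Fin 27)) : Prop := ∀ i j, rel i j = true → j ∈ S → i ∈ S

instance : DecidablePred IsLow := fun S => by unfold IsLow; infer_instance

/-- The generating function of order-reversing labellings supported in `S`. -/
def FF {R : Type} [CommSemiring R] (q : R) : ℕ → Finset (Fin 27) → R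
  | 0, _ => 1
  | k + 1, S => ∑ T ∈ S.powerset.filter IsLow, q ^ T.card * FF q k T

theorem map_FF {R R' : Type} [CommSemiring R] [CommSemiring R'] (φ : R →+* R') (q : R) (k : ℕ)
    (S : Finset (Fin 27)) : φ (FF q k S) = FF (φ q) k S := by
  induction k generalizing S with
  | zero => simp [FF]
  | succ k ih => simp [FF, ih]

/-- Bounded order-reversing labellings supported in `S`. -/
def AA (k : ℕ) (S : Finset (Fin 27)) : Finset (Fin 27 → ℕ) :=
  (Fintype.piFinset fun _ => Finset.range (k + 1)).filter fun c =>
    (∀ i j, rel i j = true → c j ≤ c i) ∧ ∀ i, i ∉ S → c i = 0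

theorem mem_AA {k : ℕ} {S : Finset (Fin 27)} {c : Fin 27 → ℕ} : c ∈ AA k S ↔
    (∀ i, c i ≤ k) ∧ (∀ i j, rel i j = true → c j ≤ c i) ∧ ∀ i, i ∉ S → c i = 0 := by
  simp [AA]

theorem sum_AA {R : Type} [CommSemiring R] (q : R) (k : ℕ) (S : Finset (Fin 27)) :
    ∑ c ∈ AA k S, q ^ (∑ i, c i) = FF q k S := by
  induction k generalizing S with
  | zero =>
    have : AA 0 S = {0} := by
      ext c
      rw [mem_AA, Finset.mem_singleton]
      constructor
      · rintro ⟨h, -⟩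
        funext i
        exact Nat.le_zero.mp (h i)
      · rintro rfl
        simp
    rw [this]
    simp [FF]
  | succ k ih =>
    rw [FF]
    have hm : ∀ c ∈ AA (k + 1) S, (Finset.univ.filter fun i => c i ≠ 0) ∈
        S.powerset.filter IsLow := by
      intro c hc
      rw [mem_AA] at hc
      obtain ⟨h1, h2, h3⟩ := hc
      rw [Finset.mem_filter, Finset.mem_powerset]
      constructor
      · intro i hi
        by_contra h
        exact (Finset.mem_filter.mp hi).2 (h3 i h)
      · intro i j hij hj
        have := h2 i j hij
        simp only [Finset.mem_filter, Finset.mem_univ, true_and] at hj ⊢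
        omega
    rw [← Finset.sum_fiberwise_of_maps_to hm]
    apply Finset.sum_congr rfl
    intro T hT
    rw [Finset.mem_filter, Finset.mem_powerset] at hT
    obtain ⟨hTS, hTl⟩ := hT
    rw [← ih T, Finset.mul_sum]
    refine Finset.sum_nbij' (fun c i => c i - 1) (fun d i => d i + if i ∈ T then 1 else 0)
      ?_ ?_ ?_ ?_ ?_
    · intro c hc
      rw [Finset.mem_filter, mem_AA] at hc
      obtain ⟨⟨h1, h2, h3⟩, rfl⟩ := hc
      rw [mem_AA]
      refine ⟨fun i => ?_, fun i j hij => ?_, fun i hi => ?_⟩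
      · have := h1 i
        show c i - 1 ≤ k
        omega
      · have := h2 i j hij
        show c j - 1 ≤ c i - 1
        omega
      · simp only [Finset.mem_filter, Finset.mem_univ, true_and, not_not] at hi
        simp [hi]
    · intro d hd
      rw [mem_AA] at hd
      obtain ⟨h1, h2, h3⟩ := hd
      rw [Finset.mem_filter, mem_AA]
      refine ⟨⟨fun i => ?_, fun i j hij => ?_, fun i hi => ?_⟩, ?_⟩
      · have := h1 i
        show d i + _ ≤ k + 1
        split_ifs <;> omega
      · have := h2 i j hij
        have h4 := hTl i j hij
        show d j + _ ≤ d i + _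
        by_cases hj : j ∈ T
        · simp [hj, h4 hj, this]
        · simp only [hj, if_false]
          omega
      · have : i ∉ T := fun h => hi (hTS h)
        simp [this, h3 i this]
      · ext i
        simp only [Finset.mem_filter, Finset.mem_univ, true_and]
        by_cases hi : i ∈ T
        · simp [hi]
        · simp [hi, h3 i hi]
    · intro c hc
      rw [Finset.mem_filter, mem_AA] at hc
      obtain ⟨-, rfl⟩ := hc
      funext i
      simp only [Finset.mem_filter, Finset.mem_univ, true_and]
      split_ifs <;> omega
    · intro d hd
      rw [mem_AA] at hd
      funext i
      by_cases hi : i ∈ T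
      · simp [hi]
      · simp [hi, hd.2.2 i hi]
    · intro c hc
      rw [Finset.mem_filter, mem_AA] at hc
      obtain ⟨-, rfl⟩ := hc
      rw [← pow_add]
      have hs : ∑ i, c i = (Finset.univ.filter fun i => c i ≠ 0).card + ∑ i, (c i - 1) := by
        rw [Finset.card_filter, ← Finset.sum_add_distrib]
        apply Finset.sum_congr rfl
        intro i _
        by_cases hi : c i = 0
        · simp [hi]
        · rw [if_pos hi]
          omega
      rw [hs]

/-! ### Transfer from `L7` -/

/-- The list of positions. -/
def elsL : List (N7 × ℕ) :=
  [(n1, 0), (n2, 1), (n3, 2), (n4, 3), (n5, 4), (n5p, 4), (n4, 5), (n6p, 5), (n3, 6),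
   (n5p, 6), (n2, 7), (n4, 7), (n1, 8), (n3, 8), (n5, 8), (n2, 9), (n4, 9), (n3, 10),
   (n5p, 10), (n4, 11), (n6p, 11), (n5, 12), (n5p, 12), (n4, 13), (n3, 14), (n2, 15), (n1, 16)]

/-- The position with given index. -/
def els (i : Fin 27) : N7 × ℕ := elsL.getD i (n1, 0)

theorem els_mem : ∀ i, els i ∈ pos7 := by decide +kernel

theorem els_inj : ∀ i j, els i = els j → i = j := by decide +kernel

theorem els_surj : ∀ x ∈ pos7, ∃ i, els i = x := by decide +kernel

theorem els_rel : ∀ i j, rel i j = true ↔ (adj7 (els i).1 (els j).1 ∧ (els j).2 = (els i).2 + 1) := by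
  decide +kernel

/-- The indexing of positions. -/
def eP : Fin 27 ≃ {x : N7 × ℕ // x ∈ pos7} :=
  Equiv.ofBijective (fun i => ⟨els i, els_mem i⟩)
    ⟨fun i j h => els_inj i j (congrArg Subtype.val h), fun x => by
      obtain ⟨i, hi⟩ := els_surj x.1 x.2
      exact ⟨i, Subtype.ext hi⟩⟩

theorem eP_val (i : Fin 27) : (eP i).1 = els i := rfl

theorem rgf_eq {R : Type} [CommSemiring R] (q : R) (k : ℕ) :
    ∑ t : L7 k, q ^ CL.rk t = FF q k Finset.univ := by
  rw [← sum_AA]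
  refine Finset.sum_bij (fun t _ i => t.1 (eP i)) ?_ ?_ ?_ ?_
  · intro t _
    rw [mem_AA]
    refine ⟨fun i => t.2.1 _, fun i j hij => t.2.2.1 _ _ ?_, by simp⟩
    rw [els_rel] at hij
    exact Relation.ReflTransGen.single ⟨(eP i).2, (eP j).2, hij.1, hij.2⟩
  · intro t _ s _ h
    apply Subtype.ext
    funext x
    have := congrFun h (eP.symm x)
    simpa using this
  · intro c hc
    rw [mem_AA] at hc
    obtain ⟨h1, h2, -⟩ := hc
    have key : ∀ a b, CL.ple adj7 pos7 a b → ∀ (ha : a ∈ pos7) (hb : b ∈ pos7),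
        c (eP.symm ⟨b, hb⟩) ≤ c (eP.symm ⟨a, ha⟩) := by
      intro a b hab
      induction hab with
      | refl => intro _ _; exact le_rfl
      | tail _ hs ih =>
        intro ha hb
        refine le_trans (h2 _ _ ?_) (ih ha hs.1)
        rw [els_rel, ← eP_val, ← eP_val]
        simp only [Equiv.apply_symm_apply]
        exact hs.2.2
    refine ⟨⟨fun x => c (eP.symm x), fun x => h1 _, fun x y hxy => key _ _ hxy _ _, trivial⟩,
      Finset.mem_univ _, ?_⟩
    funext i
    simp
  · intro t _
    have hs : CL.rk t = ∑ i, t.1 (eP i) := by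
      rw [CL.rk, ← Finset.univ_eq_attach]
      exact (Equiv.sum_comp eP t.1).symm
    rw [hs]

/-! ### Enumeration of the order ideals -/

/-- The set coded by a bit mask. -/
def toS (m : ℕ) : Finset (Fin 27) := Finset.univ.filter fun i => m.testBit i = true

theorem mem_toS {m : ℕ} {i : Fin 27} : i ∈ toS m ↔ m.testBit i = true := by simp [toS]

theorem idL_low : ∀ x ∈ idL, ∀ i j, rel i j = true → x.1.testBit (j : Fin 27) = true →
    x.1.testBit (i : Fin 27) = true := by decide +kernel

theorem idL_card : ∀ x ∈ idL, (toS x.1).card = x.2 := by decide +kernel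

theorem idL_nodup : idL.Nodup := by decide +kernel

theorem idL_lt : ∀ x ∈ idL, x.1 < 2 ^ 27 := by decide +kernel

theorem idL_ext : ∀ x ∈ idL, ∀ y ∈ idL, x.1 = y.1 → x = y := by decide +kernel

theorem idL_closed : ∀ x ∈ idL, ∀ j : Fin 27, (∀ i, rel i j = true → x.1.testBit i = true) →
    ∃ y ∈ idL, y.1 = x.1 ||| 2 ^ (j : ℕ) := by decide +kernel

theorem rel_lt : ∀ i j, rel i j = true → i < j := by decide +kernel

theorem toS_inj {m n : ℕ} (hm : m < 2 ^ 27) (hn : n < 2 ^ 27) (h : toS m = toS n) : m = n := by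
  apply Nat.eq_of_testBit_eq
  intro i
  by_cases hi : i < 27
  · have := Finset.ext_iff.mp h ⟨i, hi⟩
    rw [mem_toS, mem_toS] at this
    exact Bool.eq_iff_iff.mpr this
  · have h2 : 2 ^ 27 ≤ 2 ^ i := Nat.pow_le_pow_right (by norm_num) (by omega)
    rw [Nat.testBit_eq_false_of_lt (by omega), Nat.testBit_eq_false_of_lt (by omega)]

theorem exists_idL (n : ℕ) : ∀ S : Finset (Fin 27), S.card = n → IsLow S →
    ∃ x ∈ idL, toS x.1 = S := by
  induction n with
  | zero =>
    intro S hS _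
    refine ⟨(0, 0), by decide +kernel, ?_⟩
    rw [Finset.card_eq_zero.mp hS]
    ext i
    simp [mem_toS]
  | succ n ih =>
    intro S hS hl
    have hne : S.Nonempty := by
      rw [← Finset.card_pos]
      omega
    set j := S.max' hne with hj
    have hjS : j ∈ S := S.max'_mem hne
    obtain ⟨x, hx, hxS⟩ := ih (S.erase j) (by rw [Finset.card_erase_of_mem hjS]; omega) (by
      intro a b hab hb
      rw [Finset.mem_erase] at hb ⊢
      refine ⟨?_, hl a b hab hb.2⟩
      have h1 := rel_lt a b hab
      have h2 := S.le_max' b hb.2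
      exact ne_of_lt (lt_of_lt_of_le h1 h2))
    obtain ⟨y, hy, hyx⟩ := idL_closed x hx j (by
      intro i hij
      rw [← mem_toS, hxS, Finset.mem_erase]
      exact ⟨ne_of_lt (rel_lt i j hij), hl i j hij hjS⟩)
    refine ⟨y, hy, ?_⟩
    ext i
    rw [mem_toS, hyx, Nat.testBit_or, Nat.testBit_two_pow, Bool.or_eq_true, ← mem_toS, hxS,
      Finset.mem_erase, decide_eq_true_eq]
    constructor
    · rintro (h | h)
      · exact h.2
      · rw [← Fin.ext h]
        exact hjS
    · intro h
      by_cases hij : i = j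
      · exact Or.inr (by rw [hij])
      · exact Or.inl ⟨hij, h⟩

theorem isLow_idL {x : ℕ × ℕ} (hx : x ∈ idL) : IsLow (toS x.1) := by
  intro i j hij hj
  rw [mem_toS] at hj ⊢
  exact idL_low x hx i j hij hj

theorem subset_iff {m n : ℕ} (hm : m < 2 ^ 27) : toS m ⊆ toS n ↔ m &&& n = m := by
  constructor
  · intro h
    apply Nat.eq_of_testBit_eq
    intro i
    rw [Nat.testBit_and]
    by_cases hi : i < 27
    · have := @h ⟨i, hi⟩
      rw [mem_toS, mem_toS] at this
      simp only at this
      cases h1 : m.testBit i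
      · simp
      · simp [this h1]
    · have h2 : 2 ^ 27 ≤ 2 ^ i := Nat.pow_le_pow_right (by norm_num) (by omega)
      rw [Nat.testBit_eq_false_of_lt (show m < 2 ^ i by omega)]
      simp
  · intro h i hi
    rw [mem_toS] at hi ⊢
    rw [← h, Nat.testBit_and, Bool.and_eq_true] at hi
    exact hi.2

theorem sumL_eq (i : ℕ) (l : List ((ℕ × ℕ) × ℕ)) :
    sumL i l = (l.map fun x => if x.1.1 &&& i = x.1.1 then x.2 else 0).sum := by
  induction l with
  | nil => rfl
  | cons x xs ih =>
    have h1 : sumL i (x :: xs) = bif Nat.beq (x.1.1 &&& i) x.1.1 then x.2 + sumL i xs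
      else sumL i xs := rfl
    rw [h1, List.map_cons, List.sum_cons, ih]
    by_cases h : x.1.1 &&& i = x.1.1
    · rw [if_pos h, show Nat.beq (x.1.1 &&& i) x.1.1 = true by rw [h]; exact Nat.beq_refl _]
      rfl
    · have : Nat.beq (x.1.1 &&& i) x.1.1 = false := by
        rw [← Bool.not_eq_true]
        intro h2
        exact h (Nat.eq_of_beq_eq_true h2)
      rw [if_neg h, this]
      simp

/-- The state after `k` steps. -/
def stL (a k : ℕ) : List ((ℕ × ℕ) × ℕ) :=
  idL.map fun x => (x, a ^ x.2 * FF a k (toS x.1))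

theorem FF_succ_eq (a k i : ℕ) : FF a (k + 1) (toS i) = sumL i (stL a k) := by
  rw [sumL_eq, FF, stL, List.map_map, ← List.sum_toFinset _ idL_nodup]
  simp only [Function.comp]
  rw [← Finset.sum_filter]
  symm
  refine Finset.sum_bij (fun x _ => toS x.1) ?_ ?_ ?_ ?_
  · intro x hx
    rw [Finset.mem_filter, List.mem_toFinset] at hx
    rw [Finset.mem_filter, Finset.mem_powerset, subset_iff (idL_lt x hx.1)]
    exact ⟨hx.2, isLow_idL hx.1⟩
  · intro x hx y hy h
    rw [Finset.mem_filter, List.mem_toFinset] at hx hy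
    exact idL_ext x hx.1 y hy.1 (toS_inj (idL_lt x hx.1) (idL_lt y hy.1) h)
  · intro T hT
    rw [Finset.mem_filter, Finset.mem_powerset] at hT
    obtain ⟨x, hx, rfl⟩ := exists_idL _ T rfl hT.2
    refine ⟨x, ?_, rfl⟩
    rw [Finset.mem_filter, List.mem_toFinset, ← subset_iff (idL_lt x hx)]
    exact ⟨hx, hT.1⟩
  · intro x hx
    rw [Finset.mem_filter, List.mem_toFinset] at hx
    rw [idL_card x hx.1]

theorem initL_eq (a : ℕ) : initL a = stL a 0 := by
  simp [initL, stL, FF]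

theorem stL_succ (a k : ℕ) :
    (idL.map fun x => (x, Nat.mul (Nat.pow a x.2) (sumL x.1 (stL a k)))) = stL a (k + 1) := by
  rw [stL]
  apply List.map_congr_left
  intro x _
  rw [FF_succ_eq]
  rfl

theorem lastV_stL (a k : ℕ) : lastV (stL a k) = a ^ 27 * FF a k (toS 134217727) := rfl

theorem toS_top : toS 134217727 = Finset.univ := by decide +kernel

theorem geo_eq (a m : ℕ) : geo a m = ∑ i ∈ Finset.range m, a ^ i := by
  induction m with
  | zero => rfl
  | succ m ih =>
    have : geo a (m + 1) = a * geo a m + 1 := rfl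
    rw [this, ih, Finset.sum_range_succ', Finset.mul_sum]
    simp [pow_succ']

theorem geoProd_eq (a k : ℕ) (l : List ℕ) :
    geoProd a k l = (l.map fun m => ∑ i ∈ Finset.range (k + m), a ^ i).prod := by
  induction l with
  | nil => rfl
  | cons m l ih =>
    have : geoProd a k (m :: l) = geo a (k + m) * geoProd a k l := rfl
    rw [this, ih, geo_eq]
    simp

theorem checkL_spec (a : ℕ) (ha : 0 < a) (n : ℕ) : ∀ k, checkL a n k (stL a k) = true →
    ∀ j, j < n → FF a (k + j) Finset.univ * geoProd a 0 M7 = geoProd a (k + j) M7 := by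
  induction n with
  | zero => intro k _ j hj; omega
  | succ n ih =>
    intro k h
    have h1 : checkL a (n + 1) k (stL a k) =
      bif Nat.beq (lastV (stL a k) * geoProd a 0 M7) (a ^ 27 * geoProd a k M7) then
        mapK (fun x : ℕ × ℕ => Nat.mul (Nat.pow a x.2) (sumL x.1 (stL a k))) idL
          (checkL a n (k + 1))
      else false := rfl
    rw [h1, mapK_eq, stL_succ, Bool.cond_eq_ite, lastV_stL, toS_top] at h
    have h2 : Nat.beq (a ^ 27 * FF a k Finset.univ * geoProd a 0 M7)
        (a ^ 27 * geoProd a k M7) = true := by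
      by_contra hc
      rw [if_neg hc] at h
      exact absurd h (by simp)
    rw [if_pos h2] at h
    have h3 := Nat.eq_of_beq_eq_true h2
    rw [mul_assoc] at h3
    have h4 := Nat.eq_of_mul_eq_mul_left (pow_pos ha 27) h3
    intro j hj
    rcases j with _ | j
    · exact h4
    · have := ih (k + 1) h j (by omega)
      rw [show k + (j + 1) = k + 1 + j by ring]
      exact this

/-! ### Kronecker substitution -/

theorem coeff_eq_of_eval (a : ℕ) (i : ℕ) : ∀ P Q : Polynomial ℕ, P.eval a = Q.eval a →
    P.eval 1 < a → Q.eval 1 < a → P.coeff i = Q.coeff i := by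
  have key : ∀ (P : Polynomial ℕ) (b : ℕ), P.eval b = P.divX.eval b * b + P.coeff 0 := by
    intro P b
    conv_lhs => rw [← Polynomial.divX_mul_X_add P]
    simp
  induction i with
  | zero =>
    intro P Q h hP hQ
    rw [key P, key Q] at h
    rw [key P] at hP
    rw [key Q] at hQ
    have := congrArg (· % a) h
    simp only [Nat.mul_add_mod_self_right] at this
    rwa [Nat.mod_eq_of_lt (by omega), Nat.mod_eq_of_lt (by omega)] at this
  | succ i ih =>
    intro P Q h hP hQ
    rw [key P, key Q] at h
    rw [key P] at hP
    rw [key Q] at hQ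
    rw [← Polynomial.coeff_divX, ← Polynomial.coeff_divX]
    apply ih
    · have := congrArg (· / a) h
      have ha : 0 < a := by omega
      simp only [Nat.add_comm _ (Polynomial.coeff _ 0), Nat.add_mul_div_right _ _ ha] at this
      rwa [Nat.div_eq_of_lt (by omega), Nat.div_eq_of_lt (by omega), zero_add, zero_add] at this
    · omega
    · omega

/-- The product of `q`-integers in a commutative semiring. -/
def gp {R : Type} [CommSemiring R] (q : R) (k : ℕ) (l : List ℕ) : R :=
  (l.map fun m => ∑ i ∈ Finset.range (k + m), q ^ i).prod

theorem map_gp {R R' : Type} [CommSemiring R] [CommSemiring R'] (φ : R →+* R') (q : R) (k : ℕ)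
    (l : List ℕ) : φ (gp q k l) = gp (φ q) k l := by
  simp [gp, map_list_prod, Function.comp_def]

theorem gp_bound : ∀ k, k < 28 → geoProd 1 k M7 < bigA := by decide +kernel

theorem small_nat (k : ℕ) (hk : k < 28) :
    FF (Polynomial.X : Polynomial ℕ) k Finset.univ * gp Polynomial.X 0 M7 =
      gp Polynomial.X k M7 := by
  have e1 : ∀ a : ℕ, (FF (Polynomial.X : Polynomial ℕ) k Finset.univ *
      gp Polynomial.X 0 M7).eval a = FF a k Finset.univ * geoProd a 0 M7 := by
    intro a
    rw [geoProd_eq, ← Polynomial.coe_evalRingHom, map_mul, map_FF, map_gp]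
    simp [gp]
  have e2 : ∀ a : ℕ, (gp (Polynomial.X : Polynomial ℕ) k M7).eval a = geoProd a k M7 := by
    intro a
    rw [geoProd_eq, ← Polynomial.coe_evalRingHom, map_gp]
    simp [gp]
  have c1 := checkL_spec 1 one_pos 28 0 (by rw [← initL_eq]; exact check_one) k hk
  have c2 := checkL_spec bigA (by norm_num) 28 0 (by rw [← initL_eq]; exact check_big) k hk
  rw [zero_add] at c1 c2
  have hb := gp_bound k hk
  ext i
  refine coeff_eq_of_eval bigA i _ _ ?_ ?_ ?_
  · rw [e1, e2, c2]
  · rw [e1, c1]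
    exact hb
  · rw [e2]
    exact hb

theorem small_int (k : ℕ) (hk : k < 28) :
    FF (Polynomial.X : Polynomial ℤ) k Finset.univ * gp Polynomial.X 0 M7 =
      gp Polynomial.X k M7 := by
  have := congrArg (Polynomial.mapRingHom (Nat.castRingHom ℤ)) (small_nat k hk)
  rw [map_mul, map_FF, map_gp, map_gp] at this
  simpa using this

/-! ### Linear recurrences in `k` -/

section Rec

variable {R : Type} [CommRing R] (q : R)

/-- `f` is annihilated by the product of the operators `E - q ^ j`, `j < n`, `E` the shift. -/
def Kill : ℕ → (ℕ → R) → Prop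
  | 0, f => ∀ k, f k = 0
  | n + 1, f => Kill n fun k => f (k + 1) - q ^ n * f k

variable {q}

theorem Kill.add {n : ℕ} : ∀ {f g : ℕ → R}, Kill q n f → Kill q n g →
    Kill q n fun k => f k + g k := by
  induction n with
  | zero =>
    intro f g hf hg k
    show f k + g k = 0
    rw [hf k, hg k, add_zero]
  | succ n ih =>
    intro f g hf hg
    have := ih hf hg
    rw [Kill]
    convert this using 2
    ring

theorem Kill.smul {n : ℕ} (a : R) : ∀ {f : ℕ → R}, Kill q n f → Kill q n fun k => a * f k := by
  induction n with
  | zero =>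
    intro f hf k
    show a * f k = 0
    rw [hf k, mul_zero]
  | succ n ih =>
    intro f hf
    have := ih hf
    rw [Kill]
    convert this using 2
    ring

theorem Kill.shift {n : ℕ} : ∀ {f : ℕ → R}, Kill q n f → Kill q n fun k => f (k + 1) := by
  induction n with
  | zero => intro f hf k; exact hf (k + 1)
  | succ n ih => intro f hf; exact ih (f := fun k => f (k + 1) - q ^ n * f k) hf

theorem Kill.succ {n : ℕ} {f : ℕ → R} (hf : Kill q n f) : Kill q (n + 1) f := by
  have := hf.shift.add (hf.smul (-q ^ n))
  rw [Kill]
  convert this using 2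
  ring

theorem Kill.mono {n m : ℕ} (h : n ≤ m) {f : ℕ → R} (hf : Kill q n f) : Kill q m f := by
  induction h with
  | refl => exact hf
  | step _ ih => exact ih.succ

theorem Kill.zero (n : ℕ) : Kill q n fun _ => 0 :=
  Kill.mono (Nat.zero_le n) (show Kill q 0 fun _ => 0 from fun _ => rfl)

theorem Kill.sum {n : ℕ} {ι : Type} [DecidableEq ι] (s : Finset ι) (f : ι → ℕ → R)
    (h : ∀ i ∈ s, Kill q n (f i)) : Kill q n fun k => ∑ i ∈ s, f i k := by
  induction s using Finset.induction_on with
  | empty => simpa using Kill.zero n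
  | insert a s ha ih =>
    have h1 := (h a (Finset.mem_insert_self a s)).add
      (ih fun i hi => h i (Finset.mem_insert_of_mem hi))
    convert h1 using 2
    rw [Finset.sum_insert ha]

theorem Kill.qpow {n : ℕ} : ∀ {f : ℕ → R}, Kill q n f → Kill q (n + 1) fun k => q ^ k * f k := by
  induction n with
  | zero =>
    intro f hf
    have : (fun k => q ^ k * f k) = fun _ => 0 := by
      funext k
      rw [hf k, mul_zero]
    rw [this]
    exact Kill.zero 1
  | succ n ih =>
    intro f hf
    have := (ih hf).smul q
    rw [Kill]
    convert this using 2
    ring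

theorem Kill.eq_zero {n : ℕ} : ∀ {f : ℕ → R}, Kill q n f → (∀ i, i < n → f i = 0) →
    ∀ k, f k = 0 := by
  induction n with
  | zero => intro f hf _; exact hf
  | succ n ih =>
    intro f hf h0
    have h1 := ih hf (by
      intro i hi
      rw [h0 i (by omega), h0 (i + 1) (by omega)]
      ring)
    intro k
    induction k with
    | zero => exact h0 0 (by omega)
    | succ k ihk =>
      have := h1 k
      rw [ihk] at this
      simpa using this

theorem kill_prod (l : List ℕ) :
    Kill q (l.length + 1) fun k => (l.map fun m => q ^ (k + m) - 1).prod := by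
  induction l with
  | nil =>
    intro k
    simp
  | cons m l ih =>
    have := (ih.qpow.smul (q ^ m)).add (ih.succ.smul (-1))
    rw [List.length_cons]
    convert this using 2
    rw [List.map_cons, List.prod_cons]
    ring

theorem kill_FF (n : ℕ) : ∀ S : Finset (Fin 27), S.card = n → IsLow S →
    Kill q (n + 1) fun k => FF q k S := by
  induction n using Nat.strong_induction_on with
  | _ n ih =>
    intro S hS hl
    have h : Kill q n fun k => ∑ T ∈ (S.powerset.filter IsLow).erase S, q ^ T.card * FF q k T := by
      apply Kill.sum _ fun T k => q ^ T.card * FF q k T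
      intro T hT
      rw [Finset.mem_erase, Finset.mem_filter, Finset.mem_powerset] at hT
      have hc : T.card < n := by
        rw [← hS]
        exact Finset.card_lt_card (Finset.ssubset_iff_subset_ne.mpr ⟨hT.2.1, hT.1⟩)
      exact ((ih T.card hc T rfl hT.2.2).smul _).mono hc
    rw [Kill]
    convert h using 2 with k
    have hmem : S ∈ S.powerset.filter IsLow := by
      rw [Finset.mem_filter]
      exact ⟨Finset.mem_powerset_self S, hl⟩
    rw [FF, ← Finset.add_sum_erase _ _ hmem, hS]
    ring

end Rec

theorem gp_mul {R : Type} [CommRing R] (q : R) (k : ℕ) (l : List ℕ) :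
    (q - 1) ^ l.length * gp q k l = (l.map fun m => q ^ (k + m) - 1).prod := by
  induction l with
  | nil => simp [gp]
  | cons m l ih =>
    have : gp q k (m :: l) = (∑ i ∈ Finset.range (k + m), q ^ i) * gp q k l := by simp [gp]
    rw [this, List.map_cons, List.prod_cons, ← ih, ← geom_sum_mul, List.length_cons]
    ring

theorem all_int (k : ℕ) :
    FF (Polynomial.X : Polynomial ℤ) k Finset.univ * gp Polynomial.X 0 M7 =
      gp Polynomial.X k M7 := by
  have hlow : IsLow Finset.univ := fun _ _ _ _ => Finset.mem_univ _
  have h1 := (kill_FF (q := (Polynomial.X : Polynomial ℤ)) 27 Finset.univ (by simp) hlow).smul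
    ((Polynomial.X - 1) ^ 27 * gp Polynomial.X 0 M7)
  have h2 := (kill_prod (q := (Polynomial.X : Polynomial ℤ)) M7).smul (-1)
  have hlen : M7.length = 27 := rfl
  rw [hlen] at h2
  have h3 := (h1.add h2).eq_zero (by
    intro i hi
    have := gp_mul (Polynomial.X : Polynomial ℤ) i M7
    rw [hlen, ← small_int i hi] at this
    rw [← this]
    ring) k
  have h4 := gp_mul (Polynomial.X : Polynomial ℤ) k M7
  rw [hlen] at h4
  rw [← h4] at h3
  have hne : ((Polynomial.X : Polynomial ℤ) - 1) ^ 27 ≠ 0 :=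
    pow_ne_zero _ (Polynomial.X_sub_C_ne_zero 1)
  apply mul_left_cancel₀ hne
  linear_combination h3

/-- `RGF(L7(k);q) · ∏_{m∈M}[m]_q = ∏_{m∈M}[k+m]_q` in `ℤ[q]`. -/
theorem statement_16 (k : ℕ) :
    (∑ t : L7 k, (Polynomial.X : Polynomial ℤ) ^ CL.rk t) * (M7.map qint).prod =
      (M7.map fun m => qint (k + m)).prod := by
  rw [rgf_eq]
  have h := all_int k
  simp only [gp, zero_add] at h
  exact h

end
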